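/- arXiv:2403.14036 — 5 statements merged into one kernel-verified Lean document; each statement's English description precedes it below -/
import Mathlib

section
/- Let K be a positive integer, and for each j = 1,…,K let m_j ≤ M_j be real numbers. Let γ₀ ∈ ℝ and γ : {1,…,K} → ℝ, with γ⁺_j = max(γ_j, 0) and γ⁻_j = max(−γ_j, 0) the positive and negative parts of γ_j. Define the min–max-rescaled coefficients γ₀' = γ₀ + Σ_{j=1}^K m_j γ_j and γ_j' = (M_j − m_j) γ_j, and let γ_j'⁻ = max(−γ_j', 0). Then γ₀ + Σ_{j=1}^K m_j γ⁺_j ≥ Σ_{j=1}^K M_j γ⁻_j holds if and only if γ₀' ≥ Σ_{j=1}^K γ_j'⁻. -/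
/-- Lemma 1 proof content: under the min–max rescaling `γ₀' = γ₀ + ∑ mⱼ γⱼ`,
`γⱼ' = (Mⱼ − mⱼ) γⱼ`, the general worst-case non-crossing constraint is equivalent
to the Bondell–Reich–Wang constraint `γ₀' ≥ ∑ γⱼ'⁻`. -/
theorem fused_lasso_stmt2 (K : ℕ) (hK : 0 < K) (m M : Fin K → ℝ)
    (hmM : ∀ j, m j ≤ M j) (γ0 : ℝ) (γ : Fin K → ℝ) :
    (∑ j, M j * max (-γ j) 0 ≤ γ0 + ∑ j, m j * max (γ j) 0) ↔
      (∑ j, max (-((M j - m j) * γ j)) 0 ≤ γ0 + ∑ j, m j * γ j) := by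
  have hneg (j : Fin K) : max (-((M j - m j) * γ j)) 0 =
      M j * max (-γ j) 0 - m j * max (-γ j) 0 := by
    rw [← sub_mul, mul_max_of_nonneg _ _ (sub_nonneg.2 (hmM j)), mul_neg, mul_zero]
  have hsplit (j : Fin K) : m j * γ j = m j * max (γ j) 0 - m j * max (-γ j) 0 := by
    rw [← mul_sub, max_zero_sub_max_neg_zero_eq_self]
  rw [Finset.sum_congr rfl fun j _ => hneg j, Finset.sum_congr rfl fun j _ => hsplit j,
    Finset.sum_sub_distrib, Finset.sum_sub_distrib, ← add_sub_assoc, sub_le_sub_iff_right]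
end

section
/- Let K be a positive integer. For each j = 1,…,K, let m_j, X̄_j, M_j be real numbers with m_j < X̄_j < M_j (strict inequalities). Let γ₀ ∈ ℝ and let γ⁺_j, γ⁻_j ≥ 0 be nonnegative reals. If the adaptive non-crossing constraint C(α) holds for every α > 0, then γ⁺_j = 0 and γ⁻_j = 0 for every j. That is, in the limit α → ∞ the only feasible coefficients have all quantile-specific slope differences equal to zero, which is the composite quantile regression restriction that slope coefficients are shared across quantiles. -/
/-- The `α → ∞` limit: if the adaptive non-crossing constraint C(α) holds for every
`α > 0` (with `mⱼ < X̄ⱼ < Mⱼ` strictly), then all quantile-specific slope differences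
vanish: `γⱼ⁺ = γⱼ⁻ = 0` — the composite quantile regression restriction. -/
theorem fused_lasso_stmt7 (K : ℕ) (hK : 0 < K) (m Xbar M : Fin K → ℝ)
    (hmX : ∀ j, m j < Xbar j) (hXM : ∀ j, Xbar j < M j)
    (γ0 : ℝ) (γp γn : Fin K → ℝ) (hγp : ∀ j, 0 ≤ γp j) (hγn : ∀ j, 0 ≤ γn j)
    (h : ∀ α : ℝ, 0 < α →
      ∑ j, (Xbar j + α * (M j - Xbar j)) * γn j ≤
        γ0 + ∑ j, (Xbar j - α * (Xbar j - m j)) * γp j) :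
    ∀ j, γp j = 0 ∧ γn j = 0 := by
  have hn : ∀ j, 0 ≤ (M j - Xbar j) * γn j :=
    fun j => mul_nonneg (sub_pos.2 (hXM j)).le (hγn j)
  have hp : ∀ j, 0 ≤ (Xbar j - m j) * γp j :=
    fun j => mul_nonneg (sub_pos.2 (hmX j)).le (hγp j)
  set S := ∑ j, ((M j - Xbar j) * γn j + (Xbar j - m j) * γp j) with hS
  set B := γ0 + ∑ j, Xbar j * γp j - ∑ j, Xbar j * γn j with hB
  have bound : ∀ α : ℝ, 0 < α → α * S ≤ B := by
    intro α hα
    have hle := h α hα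
    simp only [add_mul, sub_mul (Xbar _) (α * _), mul_assoc, Finset.sum_add_distrib,
      Finset.sum_sub_distrib, ← Finset.mul_sum] at hle
    rw [hS, hB, Finset.sum_add_distrib]
    linarith
  have S_nonpos : S ≤ 0 := by
    by_contra! hpos
    have hα := bound ((|B| + 1) / S) (by positivity)
    rw [div_mul_cancel₀ _ hpos.ne'] at hα
    linarith [le_abs_self B]
  have terms_nonneg : ∀ j ∈ Finset.univ,
      0 ≤ (M j - Xbar j) * γn j + (Xbar j - m j) * γp j :=
    fun j _ => add_nonneg (hn j) (hp j)
  have S_zero : S = 0 := le_antisymm S_nonpos (Finset.sum_nonneg terms_nonneg)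
  intro j
  have hj := (Finset.sum_eq_zero_iff_of_nonneg terms_nonneg).1 S_zero j (Finset.mem_univ j)
  obtain ⟨hnj, hpj⟩ := (add_eq_zero_iff_of_nonneg (hn j) (hp j)).1 hj
  exact ⟨(mul_eq_zero.1 hpj).resolve_left (sub_pos.2 (hmX j)).ne',
    (mul_eq_zero.1 hnj).resolve_left (sub_pos.2 (hXM j)).ne'⟩
end

section
/- Let K be a positive integer. For each j = 1,…,K, let m_j, X̄_j, M_j be real numbers with m_j ≤ X̄_j ≤ M_j. Let γ₀ ∈ ℝ, let γ⁺_j, γ⁻_j ≥ 0 be nonnegative reals, and set γ_j = γ⁺_j − γ⁻_j. Suppose α ≥ 1 and the adaptive non-crossing constraint C(α) holds. Then for every x with m_j ≤ x_j ≤ M_j for all j, one has γ₀ + Σ_{j=1}^K x_j γ_j ≥ (α − 1) Σ_{j=1}^K [(X̄_j − m_j) γ⁺_j + (M_j − X̄_j) γ⁻_j] ≥ 0. In particular, C(α) with α ≥ 1 guarantees non-crossing of the fitted quantiles over the entire covariate domain, with a margin growing linearly in α − 1. -/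
/-- For `α ≥ 1`, the adaptive non-crossing constraint C(α) guarantees non-crossing
over the whole covariate box, with a margin `(α − 1) ∑ [(X̄ⱼ − mⱼ) γⱼ⁺ + (Mⱼ − X̄ⱼ) γⱼ⁻] ≥ 0`. -/
theorem fused_lasso_stmt8 (K : ℕ) (hK : 0 < K) (m Xbar M : Fin K → ℝ)
    (hmX : ∀ j, m j ≤ Xbar j) (hXM : ∀ j, Xbar j ≤ M j)
    (γ0 : ℝ) (γp γn : Fin K → ℝ) (hγp : ∀ j, 0 ≤ γp j) (hγn : ∀ j, 0 ≤ γn j)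
    (γ : Fin K → ℝ) (hγ : ∀ j, γ j = γp j - γn j)
    (α : ℝ) (hα : 1 ≤ α)
    (hC : ∑ j, (Xbar j + α * (M j - Xbar j)) * γn j ≤
        γ0 + ∑ j, (Xbar j - α * (Xbar j - m j)) * γp j) :
    ∀ x : Fin K → ℝ, (∀ j, x j ∈ Set.Icc (m j) (M j)) →
      (α - 1) * ∑ j, ((Xbar j - m j) * γp j + (M j - Xbar j) * γn j) ≤
        γ0 + ∑ j, x j * γ j ∧
      0 ≤ (α - 1) * ∑ j, ((Xbar j - m j) * γp j + (M j - Xbar j) * γn j) := by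
  intro x hx
  have h : ∑ j, ((α - 1) * ((Xbar j - m j) * γp j + (M j - Xbar j) * γn j) +
      (Xbar j - α * (Xbar j - m j)) * γp j - (Xbar j + α * (M j - Xbar j)) * γn j) ≤
      ∑ j, x j * γ j := by
    refine Finset.sum_le_sum fun j _ => ?_
    rw [hγ j]
    linarith [mul_le_mul_of_nonneg_right (hx j).1 (hγp j),
      mul_le_mul_of_nonneg_right (hx j).2 (hγn j)]
  rw [Finset.sum_sub_distrib, Finset.sum_add_distrib, ← Finset.mul_sum] at h
  exact ⟨by linarith, mul_nonneg (sub_nonneg.2 hα) <| Finset.sum_nonneg fun j _ =>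
    add_nonneg (mul_nonneg (sub_nonneg.2 (hmX j)) (hγp j))
      (mul_nonneg (sub_nonneg.2 (hXM j)) (hγn j))⟩
end

section
/- Let K be a positive integer and let x_1, …, x_T ∈ ℝ^K be a finite nonempty dataset. For each j = 1,…,K, let m_j = min_{1 ≤ t ≤ T} x_{t,j} and M_j = max_{1 ≤ t ≤ T} x_{t,j}. Let γ₀ ∈ ℝ and γ : {1,…,K} → ℝ, with γ⁺_j = max(γ_j, 0) and γ⁻_j = max(−γ_j, 0) the positive and negative parts of γ_j. If the single worst-case constraint γ₀ + Σ_{j=1}^K m_j γ⁺_j ≥ Σ_{j=1}^K M_j γ⁻_j holds, then γ₀ + Σ_{j=1}^K x_{t,j} γ_j ≥ 0 for every observation t = 1,…,T. Thus one inequality per quantile suffices to enforce the T per-observation non-crossing inequalities. -/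
/-- One worst-case inequality per quantile suffices: if `mⱼ` and `Mⱼ` are the
componentwise minimum and maximum of the data and the worst-case constraint
`γ₀ + ∑ mⱼ γⱼ⁺ ≥ ∑ Mⱼ γⱼ⁻` holds, then the per-observation non-crossing inequality
`γ₀ + ∑ x_{t,j} γⱼ ≥ 0` holds for every observation `t`. -/
theorem fused_lasso_stmt10 (K T : ℕ) (hK : 0 < K) (hT : 0 < T)
    (x : Fin T → Fin K → ℝ) (m M : Fin K → ℝ)
    (hm : ∀ j, IsLeast (Set.range fun t => x t j) (m j))
    (hM : ∀ j, IsGreatest (Set.range fun t => x t j) (M j))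
    (γ0 : ℝ) (γ : Fin K → ℝ)
    (h : ∑ j, M j * max (-γ j) 0 ≤ γ0 + ∑ j, m j * max (γ j) 0) :
    ∀ t : Fin T, 0 ≤ γ0 + ∑ j, x t j * γ j := by
  intro t
  have key : ∑ j, (m j * max (γ j) 0 - M j * max (-γ j) 0) ≤ ∑ j, x t j * γ j := by
    refine Finset.sum_le_sum fun j _ => ?_
    have hmx : m j ≤ x t j := (hm j).2 ⟨t, rfl⟩
    have hxM : x t j ≤ M j := (hM j).2 ⟨t, rfl⟩
    calc m j * max (γ j) 0 - M j * max (-γ j) 0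
        ≤ x t j * max (γ j) 0 - x t j * max (-γ j) 0 := by gcongr
      _ = x t j * γ j := by
        rw [← mul_sub, max_zero_sub_max_neg_zero_eq_self]
  rw [Finset.sum_sub_distrib] at key
  linarith
end

section
/- Let K be a positive integer. For each j = 1,…,K, let m_j, X̄_j, M_j be real numbers with m_j ≤ X̄_j ≤ M_j. Let γ₀ ∈ ℝ and γ : {1,…,K} → ℝ, with γ⁺_j = max(γ_j, 0) and γ⁻_j = max(−γ_j, 0) the positive and negative parts of γ_j, and let α ≥ 0. Then the adaptive non-crossing constraint C(α) holds if and only if γ₀ + Σ_{j=1}^K x_j γ_j ≥ 0 for every x in the box Π_{j=1}^K [(1−α) X̄_j + α m_j, (1−α) X̄_j + α M_j], i.e., the data box dilated by the factor α around the vector of covariate means. In particular, α = 0 gives the single point x = X̄, α = 1 gives the original data box Π_j [m_j, M_j], and α > 1 gives a strictly larger box. -/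
/-- An affine function is nonnegative on a box iff it is nonnegative at the vertex
minimizing it, written in terms of the positive and negative parts of its slopes. -/
theorem forall_mem_box_affine_nonneg_iff {ι : Type*} [Fintype ι] {a b : ι → ℝ}
    (hab : ∀ j, a j ≤ b j) (c : ℝ) (γ : ι → ℝ) :
    (∀ x : ι → ℝ, (∀ j, x j ∈ Set.Icc (a j) (b j)) → 0 ≤ c + ∑ j, x j * γ j) ↔
      ∑ j, b j * max (-γ j) 0 ≤ c + ∑ j, a j * max (γ j) 0 := by
  constructor
  · intro h
    have hv := h (fun j => if 0 ≤ γ j then a j else b j) fun j => by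
      split_ifs
      · exact ⟨le_rfl, hab j⟩
      · exact ⟨hab j, le_rfl⟩
    have hsum : ∑ j, (if 0 ≤ γ j then a j else b j) * γ j =
        ∑ j, a j * max (γ j) 0 - ∑ j, b j * max (-γ j) 0 := by
      rw [← Finset.sum_sub_distrib]
      refine Finset.sum_congr rfl fun j _ => ?_
      split_ifs with hj
      · rw [max_eq_left hj, max_eq_right (by linarith)]
        ring
      · rw [max_eq_right (by linarith), max_eq_left (by linarith)]
        ring
    linarith
  · intro h x hx
    have hsum : ∑ j, a j * max (γ j) 0 - ∑ j, b j * max (-γ j) 0 ≤ ∑ j, x j * γ j := by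
      rw [← Finset.sum_sub_distrib]
      refine Finset.sum_le_sum fun j _ => ?_
      obtain ⟨hax, hxb⟩ := hx j
      rcases le_total 0 (γ j) with hj | hj
      · rw [max_eq_left hj, max_eq_right (by linarith)]
        nlinarith
      · rw [max_eq_right hj, max_eq_left (by linarith)]
        nlinarith
    linarith

/-- Geometric interpretation: for `α ≥ 0`, the adaptive non-crossing constraint C(α)
holds iff `γ₀ + ∑ xⱼ γⱼ ≥ 0` for every `x` in the data box dilated by the factor `α`
around the vector of covariate means, i.e. `∏ⱼ [(1−α) X̄ⱼ + α mⱼ, (1−α) X̄ⱼ + α Mⱼ]`. -/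
theorem fused_lasso_stmt11 (K : ℕ) (hK : 0 < K) (m Xbar M : Fin K → ℝ)
    (hmX : ∀ j, m j ≤ Xbar j) (hXM : ∀ j, Xbar j ≤ M j)
    (γ0 : ℝ) (γ : Fin K → ℝ) (α : ℝ) (hα : 0 ≤ α) :
    (∑ j, (Xbar j + α * (M j - Xbar j)) * max (-γ j) 0 ≤
        γ0 + ∑ j, (Xbar j - α * (Xbar j - m j)) * max (γ j) 0) ↔
      (∀ x : Fin K → ℝ,
        (∀ j, x j ∈ Set.Icc ((1 - α) * Xbar j + α * m j) ((1 - α) * Xbar j + α * M j)) →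
          0 ≤ γ0 + ∑ j, x j * γ j) := by
  have hab : ∀ j, (1 - α) * Xbar j + α * m j ≤ (1 - α) * Xbar j + α * M j := fun j => by
    have := (hmX j).trans (hXM j)
    gcongr
  rw [forall_mem_box_affine_nonneg_iff hab]
  have hM : ∀ j, Xbar j + α * (M j - Xbar j) = (1 - α) * Xbar j + α * M j := fun j => by ring
  have hm : ∀ j, Xbar j - α * (Xbar j - m j) = (1 - α) * Xbar j + α * m j := fun j => by ring
  simp only [hM, hm]
end
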